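/- Let (𝔤,⟨·,·⟩) be a metric Lie algebra of dimension n containing an abelian ideal 𝔞 of codimension 1, let e be a unit vector orthogonal to 𝔞, Q = ad(e)|_𝔞, S = (1/2)(Q+Qᵗ), K = (1/2)(Q−Qᵗ), and P = [S,K] + S². Then the tensor Ř satisfies: Ř(X,Y) = 2⟨(P² + Tr(S²)·S² − S⁴)X, Y⟩ for all X, Y ∈ 𝔞, Ř(e,X) = 0 for all X ∈ 𝔞, and Ř(e,e) = 2·Tr(P²). -/

import Mathlib

open Module
open scoped InnerProductSpace BigOperators

noncomputable section

variable {V : Type*} [NormedAddCommGroup V] [InnerProductSpace ℝ V]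

/-- `br` is a Lie bracket: bilinear (in the first slot; bilinearity in the second slot
follows from antisymmetry), antisymmetric and satisfying the Jacobi identity. -/
structure IsLieBracket (br : V → V → V) : Prop where
  add_left : ∀ X Y Z : V, br (X + Y) Z = br X Z + br Y Z
  smul_left : ∀ (c : ℝ) (X Y : V), br (c • X) Y = c • br X Y
  antisymm : ∀ X Y : V, br X Y = - br Y X
  jacobi : ∀ X Y Z : V, br (br X Y) Z + br (br Y Z) X + br (br Z X) Y = 0

/-- `nab` is the Levi-Civita product of the metric Lie algebra `(V, ⟪·,·⟫, br)`,
determined by the Koszul formula. -/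
def IsLeviCivita (br nab : V → V → V) : Prop :=
  ∀ U W Z : V, ⟪nab U W, Z⟫_ℝ =
    (1 / 2) * (⟪br U W, Z⟫_ℝ - ⟪br W Z, U⟫_ℝ + ⟪br Z U, W⟫_ℝ)

/-- The curvature operator `R(X,Y)Z = ∇_X ∇_Y Z − ∇_Y ∇_X Z − ∇_{[X,Y]} Z`. -/
def curvOp (br nab : V → V → V) (X Y Z : V) : V :=
  nab X (nab Y Z) - nab Y (nab X Z) - nab (br X Y) Z

/-- The curvature tensor `R(X,Y,Z,W) = ⟨R(X,Y)Z, W⟩`. -/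
def curv (br nab : V → V → V) (X Y Z W : V) : ℝ :=
  ⟪curvOp br nab X Y Z, W⟫_ℝ

/-- `Ř(X,Y) = Σ_{a,b,c} R(X,e_a,e_b,e_c) R(Y,e_a,e_b,e_c)` relative to an
orthonormal basis `e`. -/
def checkR (br nab : V → V → V) {ι : Type*} [Fintype ι]
    (e : OrthonormalBasis ι ℝ V) (X Y : V) : ℝ :=
  ∑ a, ∑ b, ∑ c,
    curv br nab X (e a) (e b) (e c) * curv br nab Y (e a) (e b) (e c)

/-- The metric Lie algebra is weakly Einstein:
`Ř(X,Y) = (‖R‖²/n) ⟨X,Y⟩` where `‖R‖² = Σ_i Ř(e_i,e_i)` and `n = dim V`. -/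
def WeaklyEinstein (br nab : V → V → V) {ι : Type*} [Fintype ι]
    (e : OrthonormalBasis ι ℝ V) : Prop :=
  ∀ X Y : V, checkR br nab e X Y =
    ((∑ i, checkR br nab e (e i) (e i)) / (Fintype.card ι : ℝ)) * ⟪X, Y⟫_ℝ

/-- The Ricci form `Ric(X,Y) = Σ_a R(e_a,X,Y,e_a)`. -/
def ricci (br nab : V → V → V) {ι : Type*} [Fintype ι]
    (e : OrthonormalBasis ι ℝ V) (X Y : V) : ℝ :=
  ∑ a, curv br nab (e a) X Y (e a)

/-- The metric Lie algebra is Einstein: the Ricci form is a scalar multiple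
of the inner product. -/
def IsEinstein (br nab : V → V → V) {ι : Type*} [Fintype ι]
    (e : OrthonormalBasis ι ℝ V) : Prop :=
  ∃ κ : ℝ, ∀ X Y : V, ricci br nab e X Y = κ * ⟪X, Y⟫_ℝ

/-- A (Lie) bracket is nilpotent: all sufficiently long iterated brackets vanish. -/
def IsNilpotentBracket (br : V → V → V) : Prop :=
  ∃ k : ℕ, ∀ (f : Fin k → V) (X : V), (List.ofFn f).foldr br X = 0

namespace IsLieBracket

variable {br : V → V → V}

theorem add_right (h : IsLieBracket br) (X Y Z : V) : br X (Y + Z) = br X Y + br X Z := by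
  rw [h.antisymm, h.add_left, h.antisymm X Y, h.antisymm X Z, neg_add]

theorem smul_right (h : IsLieBracket br) (c : ℝ) (X Y : V) : br X (c • Y) = c • br X Y := by
  rw [h.antisymm, h.smul_left, h.antisymm X Y, smul_neg]

theorem self_eq_zero (h : IsLieBracket br) (X : V) : br X X = 0 := by
  have h2 := add_eq_zero_iff_eq_neg.mpr (h.antisymm X X)
  rw [← two_smul ℝ] at h2
  simpa using h2

end IsLieBracket

namespace IsLeviCivita

variable {br nab : V → V → V}

theorem add_left (h : IsLeviCivita br nab) (hbr : IsLieBracket br) (X Y Z : V) :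
    nab (X + Y) Z = nab X Z + nab Y Z := by
  refine ext_inner_right ℝ fun W => ?_
  rw [inner_add_left, h, h, h, hbr.add_left, hbr.add_right]
  simp only [inner_add_left, inner_add_right]
  ring

theorem smul_left (h : IsLeviCivita br nab) (hbr : IsLieBracket br) (c : ℝ) (X Y : V) :
    nab (c • X) Y = c • nab X Y := by
  refine ext_inner_right ℝ fun W => ?_
  rw [real_inner_smul_left, h, h, hbr.smul_left, hbr.smul_right]
  simp only [real_inner_smul_left, real_inner_smul_right]
  ring

theorem add_right (h : IsLeviCivita br nab) (hbr : IsLieBracket br) (X Y Z : V) :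
    nab X (Y + Z) = nab X Y + nab X Z := by
  refine ext_inner_right ℝ fun W => ?_
  rw [inner_add_left, h, h, h, hbr.add_left, hbr.add_right]
  simp only [inner_add_left, inner_add_right]
  ring

theorem smul_right (h : IsLeviCivita br nab) (hbr : IsLieBracket br) (c : ℝ) (X Y : V) :
    nab X (c • Y) = c • nab X Y := by
  refine ext_inner_right ℝ fun W => ?_
  rw [real_inner_smul_left, h, h, hbr.smul_left, hbr.smul_right]
  simp only [real_inner_smul_left, real_inner_smul_right]
  ring

theorem neg_left (h : IsLeviCivita br nab) (hbr : IsLieBracket br) (X Y : V) :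
    nab (-X) Y = -nab X Y := by
  simpa using h.smul_left hbr (-1) X Y

theorem neg_right (h : IsLeviCivita br nab) (hbr : IsLieBracket br) (X Y : V) :
    nab X (-Y) = -nab X Y := by
  simpa using h.smul_right hbr (-1) X Y

theorem zero_left (h : IsLeviCivita br nab) (hbr : IsLieBracket br) (X : V) :
    nab 0 X = 0 := by
  simpa using h.smul_left hbr 0 0 X

theorem zero_right (h : IsLeviCivita br nab) (hbr : IsLieBracket br) (X : V) :
    nab X 0 = 0 := by
  simpa using h.smul_right hbr 0 X 0

theorem sub_swap (h : IsLeviCivita br nab) (hbr : IsLieBracket br) (X Y : V) :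
    nab X Y - nab Y X = br X Y := by
  refine ext_inner_right ℝ fun W => ?_
  rw [inner_sub_left, h, h, hbr.antisymm Y X, hbr.antisymm X W, hbr.antisymm W Y]
  simp only [inner_neg_left]
  ring

theorem curvOp_swap (h : IsLeviCivita br nab) (hbr : IsLieBracket br) (X Y Z : V) :
    curvOp br nab Y X Z = -curvOp br nab X Y Z := by
  rw [curvOp, curvOp, hbr.antisymm Y X, h.neg_left hbr]
  abel

theorem curvOp_self (h : IsLeviCivita br nab) (hbr : IsLieBracket br) (X Z : V) :
    curvOp br nab X X Z = 0 := by
  rw [curvOp, hbr.self_eq_zero, h.zero_left hbr, sub_self, sub_zero]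

theorem isLinearMap_curv_snd (h : IsLeviCivita br nab) (hbr : IsLieBracket br) (X Z W : V) :
    IsLinearMap ℝ fun Y => curv br nab X Y Z W where
  map_add Y Y' := by
    simp only [curv, curvOp, hbr.add_right, h.add_left hbr, h.add_right hbr, inner_add_left,
      inner_sub_left]
    ring
  map_smul c Y := by
    simp only [curv, curvOp, hbr.smul_right, h.smul_left hbr, h.smul_right hbr,
      real_inner_smul_left, inner_sub_left, smul_eq_mul]
    ring

theorem isLinearMap_curv_trd (h : IsLeviCivita br nab) (hbr : IsLieBracket br) (X Y W : V) :
    IsLinearMap ℝ fun Z => curv br nab X Y Z W where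
  map_add Z Z' := by
    simp only [curv, curvOp, h.add_right hbr, inner_add_left, inner_sub_left]
    ring
  map_smul c Z := by
    simp only [curv, curvOp, h.smul_right hbr, real_inner_smul_left, inner_sub_left, smul_eq_mul]
    ring

end IsLeviCivita

theorem isLinearMap_curv_fth (br nab : V → V → V) (X Y Z : V) :
    IsLinearMap ℝ fun W => curv br nab X Y Z W where
  map_add _ _ := inner_add_right _ _ _
  map_smul _ _ := real_inner_smul_right _ _ _

theorem OrthonormalBasis.sum_mul_eq_sum_mul {ι κ : Type*} [Fintype ι] [Fintype κ]
    (b : OrthonormalBasis ι ℝ V) (c : OrthonormalBasis κ ℝ V) {φ ψ : V → ℝ}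
    (hφ : IsLinearMap ℝ φ) (hψ : IsLinearMap ℝ ψ) :
    ∑ i, φ (b i) * ψ (b i) = ∑ j, φ (c j) * ψ (c j) := by
  have hrep : ∀ {χ : V → ℝ}, IsLinearMap ℝ χ → ∃ v : V, ∀ x, χ x = ⟪v, x⟫_ℝ := by
    intro χ hχ
    refine ⟨∑ i, χ (b i) • b i, fun x => ?_⟩
    have hx : χ x = χ (∑ i, ⟪b i, x⟫_ℝ • b i) := by rw [b.sum_repr']
    have hlin : χ (∑ i, ⟪b i, x⟫_ℝ • b i) = ∑ i, ⟪b i, x⟫_ℝ * χ (b i) := by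
      rw [← hχ.mk'_apply, map_sum]
      exact Finset.sum_congr rfl fun i _ => by rw [map_smul, smul_eq_mul, hχ.mk'_apply]
    rw [hx, hlin, sum_inner]
    exact Finset.sum_congr rfl fun i _ => by rw [real_inner_smul_left, mul_comm]
  obtain ⟨v, hv⟩ := hrep hφ
  obtain ⟨w, hw⟩ := hrep hψ
  simp only [hv, hw, real_inner_comm _ w]
  rw [b.sum_inner_mul_inner, c.sum_inner_mul_inner]

theorem IsLeviCivita.checkR_eq_checkR {br nab : V → V → V} (h : IsLeviCivita br nab)
    (hbr : IsLieBracket br) {ι κ : Type*} [Fintype ι] [Fintype κ]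
    (b : OrthonormalBasis ι ℝ V) (c : OrthonormalBasis κ ℝ V) (X Y : V) :
    checkR br nab b X Y = checkR br nab c X Y := by
  simp only [checkR]
  calc _ = ∑ i, ∑ j, ∑ k, curv br nab X (b i) (b j) (c k) * curv br nab Y (b i) (b j) (c k) :=
        Finset.sum_congr rfl fun i _ => Finset.sum_congr rfl fun j _ =>
          b.sum_mul_eq_sum_mul c (isLinearMap_curv_fth br nab _ _ _)
            (isLinearMap_curv_fth br nab _ _ _)
    _ = ∑ i, ∑ k, ∑ j, curv br nab X (b i) (b j) (c k) * curv br nab Y (b i) (b j) (c k) :=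
        Finset.sum_congr rfl fun i _ => Finset.sum_comm
    _ = ∑ i, ∑ k, ∑ j, curv br nab X (b i) (c j) (c k) * curv br nab Y (b i) (c j) (c k) :=
        Finset.sum_congr rfl fun i _ => Finset.sum_congr rfl fun k _ =>
          b.sum_mul_eq_sum_mul c (h.isLinearMap_curv_trd hbr _ _ _)
            (h.isLinearMap_curv_trd hbr _ _ _)
    _ = ∑ k, ∑ j, ∑ i, curv br nab X (b i) (c j) (c k) * curv br nab Y (b i) (c j) (c k) := by
        rw [Finset.sum_comm]
        exact Finset.sum_congr rfl fun k _ => Finset.sum_comm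
    _ = ∑ k, ∑ j, ∑ i, curv br nab X (c i) (c j) (c k) * curv br nab Y (c i) (c j) (c k) :=
        Finset.sum_congr rfl fun k _ => Finset.sum_congr rfl fun j _ =>
          b.sum_mul_eq_sum_mul c (h.isLinearMap_curv_snd hbr _ _ _)
            (h.isLinearMap_curv_snd hbr _ _ _)
    _ = ∑ i, ∑ j, ∑ k, curv br nab X (c i) (c j) (c k) * curv br nab Y (c i) (c j) (c k) := by
        rw [Finset.sum_comm, Finset.sum_congr rfl fun j _ => Finset.sum_comm, Finset.sum_comm]

theorem exists_orthonormalBasis_option [FiniteDimensional ℝ V] {𝔞 : Submodule ℝ V}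
    (hcodim : finrank ℝ 𝔞 + 1 = finrank ℝ V) {e : V} (he : ‖e‖ = 1)
    (heorth : ∀ X ∈ 𝔞, ⟪e, X⟫_ℝ = 0) {κ : Type*} [Fintype κ] (f : OrthonormalBasis κ ℝ 𝔞) :
    ∃ g : OrthonormalBasis (Option κ) ℝ V, g none = e ∧ ∀ j, g (some j) = f j := by
  classical
  set v : Option κ → V := fun o => o.elim e fun j => (f j : V) with hv
  have hon : Orthonormal ℝ v := by
    rw [orthonormal_iff_ite]
    rintro (_ | i) (_ | j)
    · simp [hv, he]
    · simp [hv, heorth]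
    · simp [hv, real_inner_comm, heorth]
    · simpa [hv] using orthonormal_iff_ite.mp f.orthonormal i j
  have hcard : Fintype.card (Option κ) = finrank ℝ V := by
    rw [Fintype.card_option, ← hcodim, finrank_eq_card_basis f.toBasis]
  let B := basisOfOrthonormalOfCardEqFinrank hon hcard
  have hB : ⇑B = v := coe_basisOfOrthonormalOfCardEqFinrank hon hcard
  refine ⟨B.toOrthonormalBasis (by rwa [hB]), ?_, fun j => ?_⟩ <;>
    simp [hB, hv]

/-- In an almost abelian metric Lie algebra of dimension `n`
with abelian codimension-1 ideal `𝔞`, unit vector `e ⟂ 𝔞`, `Q = ad(e)|_𝔞`,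
`S = (1/2)(Q+Qᵗ)`, `K = (1/2)(Q−Qᵗ)`, `P = [S,K] + S²`, the tensor `Ř`
satisfies `Ř(X,Y) = 2⟨(P² + Tr(S²)S² − S⁴)X, Y⟩` for `X, Y ∈ 𝔞`,
`Ř(e,X) = 0` for `X ∈ 𝔞`, and `Ř(e,e) = 2 Tr(P²)`. -/
theorem almostAbelian_checkR_formulas
    {V : Type*} [NormedAddCommGroup V] [InnerProductSpace ℝ V] [FiniteDimensional ℝ V]
    (n : ℕ) (hdimV : finrank ℝ V = n)
    (br : V → V → V) (hbr : IsLieBracket br)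
    (nab : V → V → V) (hnab : IsLeviCivita br nab)
    (𝔞 : Submodule ℝ V)
    (hcodim : finrank ℝ 𝔞 + 1 = n)
    (habelian : ∀ X Y : V, X ∈ 𝔞 → Y ∈ 𝔞 → br X Y = 0)
    (hideal : ∀ X Y : V, Y ∈ 𝔞 → br X Y ∈ 𝔞)
    (e : V) (he : ‖e‖ = 1) (heorth : ∀ X ∈ 𝔞, ⟪e, X⟫_ℝ = 0)
    (Q : 𝔞 →ₗ[ℝ] 𝔞) (hQ : ∀ X : 𝔞, (Q X : V) = br e (X : V))
    (S : 𝔞 →ₗ[ℝ] 𝔞) (hS : S = (1 / 2 : ℝ) • (Q + LinearMap.adjoint Q))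
    (K : 𝔞 →ₗ[ℝ] 𝔞) (hK : K = (1 / 2 : ℝ) • (Q - LinearMap.adjoint Q))
    (P : 𝔞 →ₗ[ℝ] 𝔞) (hP : P = (S ∘ₗ K - K ∘ₗ S) + S ∘ₗ S)
    (basis : OrthonormalBasis (Fin n) ℝ V) :
    (∀ X Y : 𝔞, checkR br nab basis (X : V) (Y : V)
        = 2 * ⟪(P ∘ₗ P
            + (LinearMap.trace ℝ 𝔞 (S ∘ₗ S)) • (S ∘ₗ S)
            - (S ∘ₗ S) ∘ₗ (S ∘ₗ S)) X, Y⟫_ℝ) ∧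
      (∀ X : 𝔞, checkR br nab basis e (X : V) = 0) ∧
      checkR br nab basis e e = 2 * LinearMap.trace ℝ 𝔞 (P ∘ₗ P) := by
  have horth' : ∀ X : 𝔞, ⟪(X : V), e⟫_ℝ = 0 := fun X => by
    rw [real_inner_comm, heorth _ X.2]
  have horth : ∀ X : 𝔞, ⟪e, (X : V)⟫_ℝ = 0 := fun X => heorth _ X.2
  have hee : ⟪e, e⟫_ℝ = 1 := by rw [real_inner_self_eq_norm_sq, he, one_pow]
  let f := stdOrthonormalBasis ℝ 𝔞
  obtain ⟨g, hg0, hg⟩ := exists_orthonormalBasis_option (hcodim.trans hdimV.symm) he heorth f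
  have hext : ∀ u v : V, ⟪u, e⟫_ℝ = ⟪v, e⟫_ℝ → (∀ Z : 𝔞, ⟪u, (Z : V)⟫_ℝ = ⟪v, (Z : V)⟫_ℝ) →
      u = v := by
    intro u v h0 h1
    refine InnerProductSpace.ext_inner_right_basis (𝕜 := ℝ) g.toBasis fun o => ?_
    cases o with
    | none => simpa [hg0] using h0
    | some j => simpa [hg] using h1 (f j)
  have hSsymm : ∀ X Y : 𝔞, ⟪S X, Y⟫_ℝ = ⟪X, S Y⟫_ℝ := fun X Y => by
    simp only [hS, LinearMap.smul_apply, LinearMap.add_apply, real_inner_smul_left,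
      real_inner_smul_right, inner_add_left, inner_add_right, LinearMap.adjoint_inner_left,
      LinearMap.adjoint_inner_right]
    ring
  have hKskew : ∀ X Y : 𝔞, ⟪K X, Y⟫_ℝ = -⟪X, K Y⟫_ℝ := fun X Y => by
    simp only [hK, LinearMap.smul_apply, LinearMap.sub_apply, real_inner_smul_left,
      real_inner_smul_right, inner_sub_left, inner_sub_right, LinearMap.adjoint_inner_left,
      LinearMap.adjoint_inner_right]
    ring
  have hPsymm : ∀ X Y : 𝔞, ⟪P X, Y⟫_ℝ = ⟪X, P Y⟫_ℝ := fun X Y => by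
    simp only [hP, LinearMap.add_apply, LinearMap.sub_apply, LinearMap.comp_apply,
      inner_sub_left, inner_sub_right, inner_add_left, inner_add_right, hSsymm, hKskew]
    ring
  have hQSK : ∀ X : 𝔞, Q X = S X + K X := fun X => by
    simp only [hS, hK, LinearMap.smul_apply, LinearMap.add_apply, LinearMap.sub_apply]
    module
  have hQ' : ∀ X : 𝔞, br (X : V) e = -(Q X : V) := fun X => by rw [hbr.antisymm, hQ]
  have hab : ∀ X Y : 𝔞, br (X : V) Y = 0 := fun X Y => habelian _ _ X.2 Y.2
  have hinner : ∀ X Y : 𝔞, ⟪(X : V), (Y : V)⟫_ℝ = ⟪X, Y⟫_ℝ := fun X Y => rfl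
  have nab_ee : nab e e = 0 := by
    refine hext _ _ ?_ fun Z => ?_
    · rw [hnab]; simp [hbr.self_eq_zero]
    · rw [hnab]; simp [hbr.self_eq_zero, ← hQ, hQ', horth']
  have nab_eX : ∀ X : 𝔞, nab e X = K X := fun X => by
    refine hext _ _ ?_ fun Z => ?_
    · rw [hnab]; simp [hbr.self_eq_zero, ← hQ, hQ', horth']
    · rw [hnab, ← hQ, hQ', hab, inner_neg_left, inner_zero_left, hinner, hinner, hinner, hQSK,
        hQSK, inner_add_left, inner_add_left, hSsymm Z X, hKskew Z X, real_inner_comm (S X) Z,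
        real_inner_comm (K X) Z]
      ring
  have nab_Xe : ∀ X : 𝔞, nab X e = -(S X : V) := fun X => by
    have h := hnab.sub_swap hbr e X
    rw [nab_eX, ← hQ, hQSK, Submodule.coe_add] at h
    linear_combination (norm := module) (-1 : ℝ) • h
  have nab_XY : ∀ X Y : 𝔞, nab X Y = ⟪S X, Y⟫_ℝ • e := fun X Y => by
    refine hext _ _ ?_ fun Z => ?_
    · rw [hnab, ← hQ, hQ', hab, inner_neg_left, inner_zero_left, hinner, hinner,
        real_inner_smul_left, hee, hQSK, hQSK, inner_add_left, inner_add_left, hSsymm Y X,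
        hKskew Y X, real_inner_comm (S X) Y, real_inner_comm (K X) Y]
      ring
    · rw [hnab, hab, hab, hab, real_inner_smul_left, horth]
      simp
  have curvOp_XYZ : ∀ X Y Z : 𝔞, curvOp br nab X Y Z
      = ((⟪S X, Z⟫_ℝ • S Y - ⟪S Y, Z⟫_ℝ • S X : 𝔞) : V) := fun X Y Z => by
    rw [curvOp, nab_XY, nab_XY, hab, hnab.zero_left hbr, hnab.smul_right hbr,
      hnab.smul_right hbr, nab_Xe, nab_Xe]
    push_cast
    module
  have curvOp_XYe : ∀ X Y : 𝔞, curvOp br nab X Y e = 0 := fun X Y => by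
    rw [curvOp, nab_Xe, nab_Xe, hab, hnab.zero_left hbr, hnab.neg_right hbr,
      hnab.neg_right hbr, nab_XY, nab_XY, real_inner_comm (S X) (S Y)]
    simp
  have hPX : ∀ X : 𝔞, P X = S (Q X) - K (S X) := fun X => by
    simp only [hP, hQSK, LinearMap.add_apply, LinearMap.sub_apply, LinearMap.comp_apply, map_add]
    abel
  have curvOp_XeZ : ∀ X Z : 𝔞, curvOp br nab X e Z = ⟪P X, Z⟫_ℝ • e := fun X Z => by
    rw [curvOp, nab_eX, nab_XY, nab_XY, hQ', hnab.neg_left hbr, nab_XY, hnab.smul_right hbr,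
      nab_ee, hPX, inner_sub_left, hKskew]
    module
  have curvOp_Xee : ∀ X : 𝔞, curvOp br nab X e e = ((-P X : 𝔞) : V) := fun X => by
    rw [curvOp, nab_ee, nab_Xe, hQ', hnab.neg_left hbr, nab_Xe, hnab.zero_right hbr,
      hnab.neg_right hbr, nab_eX, hPX]
    push_cast
    abel
  have curvOp_eXZ : ∀ X Z : 𝔞, curvOp br nab e X Z = -(⟪P X, Z⟫_ℝ • e) := fun X Z => by
    rw [hnab.curvOp_swap hbr X, curvOp_XeZ]
  have curvOp_eXe : ∀ X : 𝔞, curvOp br nab e X e = (P X : V) := fun X => by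
    rw [hnab.curvOp_swap hbr X, curvOp_Xee]; simp
  have hsum : ∀ X Y : 𝔞, ∑ j, ⟪X, f j⟫_ℝ * ⟪Y, f j⟫_ℝ = ⟪X, Y⟫_ℝ := fun X Y => by
    rw [← f.sum_inner_mul_inner]
    exact Finset.sum_congr rfl fun j _ => by rw [real_inner_comm Y]
  have htrace : ∀ T : 𝔞 →ₗ[ℝ] 𝔞, (∀ X Y, ⟪T X, Y⟫_ℝ = ⟪X, T Y⟫_ℝ) →
      LinearMap.trace ℝ 𝔞 (T ∘ₗ T) = ∑ j, ⟪T (f j), T (f j)⟫_ℝ := fun T hT => by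
    rw [LinearMap.trace_eq_sum_inner _ f]
    exact Finset.sum_congr rfl fun j _ => by rw [LinearMap.comp_apply, hT]
  simp only [hnab.checkR_eq_checkR hbr basis g]
  simp only [checkR, curv, Fintype.sum_option, hg0, hg,
    curvOp_XYZ, curvOp_XYe, curvOp_XeZ, curvOp_Xee, curvOp_eXZ, curvOp_eXe,
    hnab.curvOp_self hbr, inner_zero_left, inner_neg_left, real_inner_smul_left, horth, horth',
    hee, hinner, mul_zero, zero_mul, mul_one, neg_zero, add_zero, zero_add,
    Finset.sum_const_zero, neg_mul_neg, implies_true, true_and]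
  refine ⟨fun X Y => ?_, ?_⟩
  · have hwedge : ∀ A B C : 𝔞,
        ∑ j, ⟪⟪A, f j⟫_ℝ • C - ⟪C, f j⟫_ℝ • A, ⟪B, f j⟫_ℝ • C - ⟪C, f j⟫_ℝ • B⟫_ℝ
          = 2 * (⟪C, C⟫_ℝ * ⟪A, B⟫_ℝ - ⟪A, C⟫_ℝ * ⟪B, C⟫_ℝ) := fun A B C => by
      calc _ = ∑ j, (⟪C, C⟫_ℝ * (⟪A, f j⟫_ℝ * ⟪B, f j⟫_ℝ)
              - ⟪B, C⟫_ℝ * (⟪A, f j⟫_ℝ * ⟪C, f j⟫_ℝ)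
              - ⟪A, C⟫_ℝ * (⟪B, f j⟫_ℝ * ⟪C, f j⟫_ℝ)
              + ⟪A, B⟫_ℝ * (⟪C, f j⟫_ℝ * ⟪C, f j⟫_ℝ)) :=
            Finset.sum_congr rfl fun j _ => by
              simp only [inner_sub_left, inner_sub_right, real_inner_smul_left,
                real_inner_smul_right, real_inner_comm B C]
              ring
        _ = _ := by
            simp only [Finset.sum_add_distrib, Finset.sum_sub_distrib, ← Finset.mul_sum, hsum]
            ring
    have hcross : ∑ j, ⟪S X, S (f j)⟫_ℝ * ⟪S Y, S (f j)⟫_ℝ = ⟪S (S X), S (S Y)⟫_ℝ := by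
      simp only [← hSsymm, hsum]
    simp only [hsum, hwedge]
    simp only [← Finset.mul_sum, Finset.sum_sub_distrib, ← Finset.sum_mul, hcross,
      ← htrace S hSsymm]
    simp only [LinearMap.add_apply, LinearMap.sub_apply, LinearMap.smul_apply,
      inner_add_left, inner_sub_left, real_inner_smul_left, LinearMap.comp_apply]
    rw [hPsymm (P X), hSsymm (S X) Y, hSsymm (S (S (S X))), hSsymm (S (S X))]
    ring
  · simp only [hsum, Finset.sum_add_distrib, ← htrace P hPsymm]
    ring
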